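/- Let (A_N)_{N>0} and (B_N)_{N>0} be real-valued random variables on a probability space (Ω, ℱ, ℙ) and (𝒢_N)_{N>0} sub-σ-algebras of ℱ such that B_N is 𝒢_N-measurable for each N. Let σ_A², σ_B² ≥ 0. Assume: (i) √N · B_N converges in distribution to the centred Gaussian law N(0, σ_B²) as N → ∞; (ii) for every u ∈ ℝ, the conditional characteristic function 𝔼[exp(i u √N A_N) ∣ 𝒢_N] converges in probability to exp(−u² σ_A² / 2) as N → ∞. Then √N (A_N + B_N) converges in distribution to N(0, σ_A² + σ_B²) as N → ∞. -/

import Mathlib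

open MeasureTheory ProbabilityTheory Filter
open scoped Classical BigOperators Topology

/-- Weak convergence of the laws of real random variables, expressed through bounded continuous test
functions, is pointwise convergence of the characteristic functions (Lévy). -/
lemma tendsto_integral_boundedContinuous_iff_tendsto_charFun
    {Ω : Type*} [MeasurableSpace Ω] {P : Measure Ω} [IsProbabilityMeasure P]
    {X : ℕ → Ω → ℝ} (hX : ∀ n, Measurable (X n)) (μ : Measure ℝ) [IsProbabilityMeasure μ] :
    (∀ f : BoundedContinuousFunction ℝ ℝ,
      Tendsto (fun n => ∫ ω, f (X n ω) ∂P) atTop (𝓝 (∫ x, f x ∂μ))) ↔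
    ∀ t : ℝ, Tendsto (fun n => ∫ ω, Complex.exp (t * X n ω * Complex.I) ∂P) atTop
      (𝓝 (charFun μ t)) := by
  let ν : ℕ → ProbabilityMeasure ℝ := fun n =>
    ⟨P.map (X n), Measure.isProbabilityMeasure_map (hX n).aemeasurable⟩
  have hint (f : BoundedContinuousFunction ℝ ℝ) (n : ℕ) :
      ∫ x, f x ∂(ν n : Measure ℝ) = ∫ ω, f (X n ω) ∂P :=
    integral_map (hX n).aemeasurable f.continuous.aestronglyMeasurable
  have hchar (t : ℝ) (n : ℕ) :
      charFun (ν n : Measure ℝ) t = ∫ ω, Complex.exp (t * X n ω * Complex.I) ∂P := by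
    rw [charFun_apply_real]
    exact integral_map (hX n).aemeasurable
      (Continuous.aestronglyMeasurable (by fun_prop))
  have key := (ProbabilityMeasure.tendsto_iff_forall_integral_tendsto
    (μs := ν) (μ := ⟨μ, inferInstance⟩) (F := atTop)).symm.trans
    ProbabilityMeasure.tendsto_iff_tendsto_charFun
  simpa only [hint, hchar, ProbabilityMeasure.coe_mk] using key

/-- **Bounded convergence theorem** for convergence in measure: a uniformly bounded sequence
converging in measure converges in `L¹`. -/
lemma tendsto_integral_norm_sub_of_tendstoInMeasure_of_bound
    {Ω E : Type*} [MeasurableSpace Ω] {P : Measure Ω} [IsFiniteMeasure P] [NormedAddCommGroup E]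
    {f : ℕ → Ω → E} {g : Ω → E} {C : ℝ} (hf : ∀ n, AEStronglyMeasurable (f n) P)
    (hfC : ∀ n, ∀ᵐ ω ∂P, ‖f n ω‖ ≤ C) (hg : Integrable g P)
    (hfg : TendstoInMeasure P f atTop g) :
    Tendsto (fun n => ∫ ω, ‖f n ω - g ω‖ ∂P) atTop (𝓝 0) := by
  refine tendsto_of_subseq_tendsto fun ns hns => ?_
  obtain ⟨ms, -, hms⟩ := (hfg.comp hns).exists_seq_tendsto_ae
  refine ⟨ms, ?_⟩
  rw [← integral_zero Ω ℝ (μ := P)]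
  refine tendsto_integral_of_dominated_convergence (fun ω => C + ‖g ω‖)
    (fun n => ((hf _).sub hg.1).norm) ((integrable_const C).add hg.norm) (fun n => ?_) ?_
  · filter_upwards [hfC (ns (ms n))] with ω hω
    rw [norm_norm]
    exact (norm_sub_le _ _).trans (by gcongr)
  · filter_upwards [hms] with ω hω
    exact tendsto_iff_norm_sub_tendsto_zero.1 hω

/-- If `b n` is `𝒢 n`-measurable and bounded by `1`, and the conditional expectations of the
bounded variables `a n` converge in probability to a constant `c`, then `𝔼[b n * a n]` and
`𝔼[b n] * c` are asymptotically equal. -/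
lemma tendsto_integral_mul_sub_of_tendstoInMeasure_condExp
    {Ω : Type*} [m0 : MeasurableSpace Ω] {P : Measure Ω} [IsFiniteMeasure P]
    {𝒢 : ℕ → MeasurableSpace Ω} (h𝒢 : ∀ n, 𝒢 n ≤ m0) {a b : ℕ → Ω → ℂ} {c : ℂ} {C : ℝ}
    (ha : ∀ n, AEStronglyMeasurable (a n) P) (haC : ∀ n ω, ‖a n ω‖ ≤ C)
    (hb : ∀ n, StronglyMeasurable[𝒢 n] (b n)) (hb1 : ∀ n ω, ‖b n ω‖ ≤ 1)
    (hac : TendstoInMeasure P (fun n => P[a n | 𝒢 n]) atTop (fun _ => c)) :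
    Tendsto (fun n => ∫ ω, b n ω * a n ω ∂P - (∫ ω, b n ω ∂P) * c) atTop (𝓝 0) := by
  have hbm (n : ℕ) : AEStronglyMeasurable (b n) P := ((hb n).mono (h𝒢 n)).aestronglyMeasurable
  have hbi (n : ℕ) : Integrable (b n) P := .of_bound (hbm n) 1 (ae_of_all _ (hb1 n))
  have hai (n : ℕ) : Integrable (a n) P := .of_bound (ha n) C (ae_of_all _ (haC n))
  have hL1 := tendsto_integral_norm_sub_of_tendstoInMeasure_of_bound
    (fun n => integrable_condExp.aestronglyMeasurable)
    (fun n => ae_bdd_norm_condExp_of_ae_bdd_norm (ae_of_all _ (haC n))) (integrable_const c) hac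
  refine squeeze_zero_norm (fun n => ?_) hL1
  have hpull : ∫ ω, b n ω * a n ω ∂P = ∫ ω, b n ω * (P[a n | 𝒢 n]) ω ∂P := by
    rw [← integral_condExp (h𝒢 n)]
    exact integral_congr_ae (condExp_bilin_of_stronglyMeasurable_left (.mul ℝ ℂ) (hb n)
      ((hai n).bdd_mul (hbm n) (ae_of_all _ (hb1 n))) (hai n))
  have hφ : Integrable (P[a n | 𝒢 n]) P := integrable_condExp
  rw [hpull, ← integral_mul_const,
    ← integral_sub (hφ.bdd_mul (hbm n) (ae_of_all _ (hb1 n))) ((hbi n).mul_const c)]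
  refine norm_integral_le_of_norm_le (hφ.sub (integrable_const c)).norm (ae_of_all _ fun ω => ?_)
  rw [← mul_sub, norm_mul]
  exact mul_le_of_le_one_left (norm_nonneg _) (hb1 n ω)

/-- **A conditional joint CLT** (Lemma: if `√N B_N ⇒ N(0, σ_B²)` with `B_N`
`𝒢_N`-measurable, and the conditional characteristic functions of `√N A_N` given `𝒢_N`
converge in probability to that of `N(0, σ_A²)`, then
`√N (A_N + B_N) ⇒ N(0, σ_A² + σ_B²)`; convergence in distribution is expressed by
testing against all bounded continuous functions, and `gaussianReal 0 0 = δ₀`). -/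
theorem conditional_joint_clt
    {Ω : Type*} [m0 : MeasurableSpace Ω]
    (P : Measure Ω) [IsProbabilityMeasure P]
    (A B : ℕ → Ω → ℝ)
    (hA_meas : ∀ N, Measurable (A N))
    (𝒢 : ℕ → MeasurableSpace Ω) (h𝒢 : ∀ N, 𝒢 N ≤ m0)
    (hB_meas : ∀ N, Measurable[𝒢 N] (B N))
    (vA vB : NNReal)
    -- (i) `√N B_N ⇒ N(0, σ_B²)`
    (hB : ∀ f : BoundedContinuousFunction ℝ ℝ,
      Tendsto (fun N : ℕ => ∫ ω, f (Real.sqrt N * B N ω) ∂P)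
        atTop (𝓝 (∫ x, f x ∂gaussianReal 0 vB)))
    -- (ii) `𝔼[exp(iu√N A_N) ∣ 𝒢_N] → exp(−u²σ_A²/2)` in probability, for every `u`
    (hA : ∀ u : ℝ,
      TendstoInMeasure P
        (fun N : ℕ =>
          P[(fun ω => Complex.exp (Complex.I * u * Real.sqrt N * A N ω)) | 𝒢 N])
        atTop
        (fun _ => Complex.exp ((-(u ^ 2 * (vA : ℝ)) / 2 : ℝ)))) :
    -- conclusion: `√N (A_N + B_N) ⇒ N(0, σ_A² + σ_B²)`
    ∀ f : BoundedContinuousFunction ℝ ℝ,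
      Tendsto (fun N : ℕ => ∫ ω, f (Real.sqrt N * (A N ω + B N ω)) ∂P)
        atTop (𝓝 (∫ x, f x ∂gaussianReal 0 (vA + vB))) := by
  have hBm (N : ℕ) : Measurable (B N) := (hB_meas N).mono (h𝒢 N) le_rfl
  rw [tendsto_integral_boundedContinuous_iff_tendsto_charFun
    (fun N => (hBm N).const_mul (Real.sqrt N))] at hB
  refine (tendsto_integral_boundedContinuous_iff_tendsto_charFun
    (fun N => ((hA_meas N).add (hBm N)).const_mul (Real.sqrt N)) _).2 ?_
  intro t
  have hdiff := tendsto_integral_mul_sub_of_tendstoInMeasure_condExp h𝒢 (C := 1)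
    (a := fun N ω => Complex.exp (Complex.I * t * Real.sqrt N * A N ω))
    (b := fun N ω => Complex.exp (t * (Real.sqrt N * B N ω : ℝ) * Complex.I))
    (fun N => by
      have := hA_meas N
      exact Measurable.aestronglyMeasurable (by fun_prop))
    (fun N ω => by simp [Complex.norm_exp])
    (fun N => by
      have := hB_meas N
      exact Measurable.stronglyMeasurable (by fun_prop))
    (fun N ω => by simp [Complex.norm_exp]) (hA t)
  convert hdiff.add ((hB t).mul_const
    (Complex.exp ((-(t ^ 2 * (vA : ℝ)) / 2 : ℝ)))) using 2 with N
  · rw [sub_add_cancel]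
    refine integral_congr_ae (ae_of_all _ fun ω => ?_)
    simp only [← Complex.exp_add, Pi.add_apply]
    push_cast
    ring_nf
  · rw [charFun_gaussianReal, charFun_gaussianReal, zero_add,
      ← Complex.exp_add]
    push_cast
    ring_nf
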